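/- arXiv:0812.0972 — 3 statements merged into one kernel-verified Lean document; each statement's English description precedes it below -/
import Mathlib

section
/- (Hamming bound) Let F be a finite field with q elements and let C ⊆ F^n be a code such that any two distinct codewords have Hamming distance at least d. Then |C| · Σ_{i=0}^{⌊(d−1)/2⌋} C(n, i) (q − 1)^i ≤ q^n. In particular, for a linear code of dimension k this gives Σ_{i=0}^{⌊(d−1)/2⌋} C(n, i) (q − 1)^i ≤ q^{n−k}. -/
open Finset in
/-- The number of vectors with support exactly `s` is `(|R| - 1) ^ |s|`. -/
theorem card_filter_support_eq {ι R : Type*} [Fintype ι] [DecidableEq ι] [Fintype R]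
    [DecidableEq R] [Zero R] (s : Finset ι) :
    #{x : ι → R | ({i | x i ≠ 0} : Finset ι) = s} = (Fintype.card R - 1) ^ #s := by
  have h : ({x : ι → R | ({i | x i ≠ 0} : Finset ι) = s} : Finset (ι → R)) =
      Fintype.piFinset fun i => if i ∈ s then univ.erase 0 else {0} := by
    ext x
    simp only [mem_filter, mem_univ, true_and, Fintype.mem_piFinset, Finset.ext_iff]
    refine forall_congr' fun i => ?_
    by_cases hi : i ∈ s <;> simp [hi]
  rw [h, Fintype.card_piFinset]
  simp [apply_ite Finset.card, card_erase_of_mem]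

open Finset in
/-- The number of vectors of Hamming weight `k` is `C(|ι|, k) (|R| - 1) ^ k`. -/
theorem card_filter_hammingNorm_eq (ι R : Type*) [Fintype ι] [DecidableEq ι] [Fintype R]
    [DecidableEq R] [Zero R] (k : ℕ) :
    #{x : ι → R | hammingNorm x = k} =
      (Fintype.card ι).choose k * (Fintype.card R - 1) ^ k := by
  rw [card_eq_sum_card_fiberwise (f := fun x : ι → R => ({i | x i ≠ 0} : Finset ι))
    (t := powersetCard k univ) (fun x hx => by simpa [hammingNorm] using hx)]
  rw [← card_univ (α := ι), ← card_powersetCard, ← smul_eq_mul]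
  refine sum_eq_card_nsmul fun s hs => ?_
  have hs : #s = k := (mem_powersetCard.mp hs).2
  rw [filter_filter, ← hs, ← card_filter_support_eq (R := R) s]
  congr 1
  ext x
  simp only [mem_filter, mem_univ, true_and, and_iff_right_iff_imp]
  rintro rfl
  rfl

open Finset in
/-- The number of vectors in a Hamming ball of radius `r` around the origin. -/
theorem card_filter_hammingNorm_le (ι R : Type*) [Fintype ι] [DecidableEq ι] [Fintype R]
    [DecidableEq R] [Zero R] (r : ℕ) :
    #{x : ι → R | hammingNorm x ≤ r} =
      ∑ i ∈ range (r + 1), (Fintype.card ι).choose i * (Fintype.card R - 1) ^ i := by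
  rw [card_eq_sum_card_fiberwise (f := fun x : ι → R => hammingNorm x)
    (t := range (r + 1)) (fun x hx => by simpa [Nat.lt_succ_iff] using hx)]
  refine sum_congr rfl fun i hi => ?_
  rw [filter_filter, ← card_filter_hammingNorm_eq]
  congr 1
  ext x
  simp only [mem_filter, mem_univ, true_and, and_iff_right_iff_imp]
  rintro rfl
  exact Nat.lt_succ_iff.mp (mem_range.mp hi)

open Finset in
/-- Translates of a Hamming ball of radius `r` by vectors at pairwise distance greater than `2 r`
are disjoint, so their total size is at most that of the whole space. -/
theorem card_mul_card_filter_hammingNorm_le {ι R : Type*} [Fintype ι] [DecidableEq ι] [Fintype R]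
    [DecidableEq R] [AddCommGroup R] (C : Finset (ι → R)) (r : ℕ)
    (hC : ∀ u ∈ C, ∀ v ∈ C, u ≠ v → 2 * r < hammingDist u v) :
    #C * #{x : ι → R | hammingNorm x ≤ r} ≤ Fintype.card R ^ Fintype.card ι := by
  rw [← card_product, ← Fintype.card_fun, ← card_univ]
  refine card_le_card_of_injOn (fun p => p.1 + p.2) (fun _ _ => mem_coe.mpr (mem_univ _)) ?_
  rintro ⟨u, x⟩ hu ⟨v, y⟩ hv (h : u + x = v + y)
  simp only [mem_coe, mem_product, mem_filter, mem_univ, true_and] at hu hv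
  have huv : u = v := by
    by_contra hne
    have hlt := hC u hu.1 v hv.1 hne
    have hsub : -u + v = -y + x := by
      rw [eq_neg_add_iff_add_eq, add_left_comm, add_comm y v, ← h, neg_add_cancel_left]
    have hd : hammingDist u v = hammingDist y x := by
      rw [hammingDist_eq_hammingNorm, hammingDist_eq_hammingNorm, hsub]
    have htri := hammingDist_triangle y 0 x
    rw [hammingDist_zero_right, hammingDist_zero_left] at htri
    omega
  subst huv
  rw [add_left_cancel h]


/-- Hamming (sphere-packing) bound: if any two distinct codewords of `C ⊆ F^n` are at
Hamming distance at least `d` and `|F| = q`, then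
`|C| · ∑_{i=0}^{⌊(d-1)/2⌋} C(n,i) (q-1)^i ≤ q^n`.  In particular, for a linear code of
dimension `k`, `∑_{i=0}^{⌊(d-1)/2⌋} C(n,i) (q-1)^i ≤ q^{n-k}`. -/
theorem hamming_bound {F : Type*} [Field F] [Fintype F] [DecidableEq F] {n d : ℕ}
    (q : ℕ) (hq : q = Fintype.card F) (C : Finset (Fin n → F))
    (hdist : ∀ u ∈ C, ∀ v ∈ C, u ≠ v → d ≤ hammingDist u v) :
    C.card * ∑ i ∈ Finset.range ((d - 1) / 2 + 1), n.choose i * (q - 1) ^ i ≤ q ^ n ∧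
    ∀ (S : Submodule F (Fin n → F)) (k : ℕ), (S : Set (Fin n → F)) = ↑C →
      Module.finrank F S = k →
      ∑ i ∈ Finset.range ((d - 1) / 2 + 1), n.choose i * (q - 1) ^ i ≤ q ^ (n - k) := by
  subst hq
  have hbound : C.card * ∑ i ∈ Finset.range ((d - 1) / 2 + 1),
      n.choose i * (Fintype.card F - 1) ^ i ≤ Fintype.card F ^ n := by
    have h := card_mul_card_filter_hammingNorm_le C ((d - 1) / 2) fun u hu v hv huv => by
      have := hdist u hu v hv huv
      have := hammingDist_pos.mpr huv
      omega
    rwa [card_filter_hammingNorm_le, Fintype.card_fin] at h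
  refine ⟨hbound, fun S k hS hk => ?_⟩
  have hcard : C.card = Fintype.card F ^ k := by
    rw [← Set.ncard_coe_finset, ← hS, ← hk, ← Nat.card_eq_fintype_card,
      ← Module.natCard_eq_pow_finrank (K := F) (V := S)]
    rfl
  have hkn : k ≤ n := by
    simpa [hk] using S.finrank_le
  rw [hcard, ← pow_mul_pow_sub _ hkn] at hbound
  exact Nat.le_of_mul_le_mul_left hbound (pow_pos Fintype.card_pos k)
end

section
/- (BCH bound) Let F be a finite field, let E be a field extension of F, let n ≥ 1 with α ∈ E an element of multiplicative order exactly n (a primitive n-th root of unity), and let 2 ≤ d ≤ n. If c ∈ F^n is a nonzero vector satisfying Σ_{j=0}^{n−1} c_j α^{ij} = 0 for every i = 1, 2, …, d − 1, then the Hamming weight of c is at least d. Consequently, the minimum distance of a narrow-sense BCH code of designed distance d is at least d. -/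
/-- BCH bound: if `α` is a primitive `n`-th root of unity in a field extension `E` of a
finite field `F`, `2 ≤ d ≤ n`, and `c ∈ F^n` is a nonzero vector with
`∑_{j=0}^{n-1} c_j α^{i·j} = 0` for all `i = 1, …, d - 1`, then the Hamming weight of
`c` is at least `d`.  Hence a narrow-sense BCH code of designed distance `d` has
minimum distance at least `d`. -/
theorem bch_bound {F E : Type*} [Field F] [Fintype F] [DecidableEq F] [Field E]
    [Algebra F E] {n d : ℕ} (hn : 1 ≤ n) (α : E) (hα : orderOf α = n)
    (hd2 : 2 ≤ d) (hdn : d ≤ n) (c : Fin n → F) (hc : c ≠ 0)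
    (hzero : ∀ i : ℕ, 1 ≤ i → i ≤ d - 1 →
      ∑ j : Fin n, algebraMap F E (c j) * α ^ (i * (j : ℕ)) = 0) :
    d ≤ hammingNorm c := by
  classical
  by_contra! hlt
  set s : Finset (Fin n) := {j | c j ≠ 0} with hs
  have hcard : s.card < d := hlt
  have hα0 : α ≠ 0 := by
    rintro rfl
    simp only [orderOf_zero] at hα
    omega
  let e := s.equivFin.symm
  have hinj : Function.Injective fun k => α ^ ((e k : Fin n) : ℕ) := fun k l hkl =>
    e.injective <| Subtype.ext <| Fin.ext <|
      pow_injOn_Iio_orderOf (by simp [hα]) (by simp [hα]) hkl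
  have hf : (fun k => algebraMap F E (c (e k)) * α ^ ((e k : Fin n) : ℕ)) = 0 := by
    refine Matrix.eq_zero_of_forall_pow_sum_mul_pow_eq_zero hinj fun i => ?_
    rw [e.sum_comp fun j : s =>
        algebraMap F E (c j) * α ^ ((j : Fin n) : ℕ) * (α ^ ((j : Fin n) : ℕ)) ^ (i : ℕ),
      Finset.sum_coe_sort s fun j =>
        algebraMap F E (c j) * α ^ (j : ℕ) * (α ^ (j : ℕ)) ^ (i : ℕ),
      Finset.sum_subset s.subset_univ (by intro j _ hj; simp_all),
      ← hzero (i + 1) (by omega) (by omega)]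
    exact Finset.sum_congr rfl fun j _ => by ring
  obtain ⟨j, hj⟩ := Function.ne_iff.mp hc
  have hjs : j ∈ s := by simpa [hs] using hj
  have hzero_j := congr_fun hf (e.symm ⟨j, hjs⟩)
  simp only [Equiv.apply_symm_apply, Pi.zero_apply, mul_eq_zero, pow_eq_zero_iff',
    hα0, false_and, or_false, map_eq_zero] at hzero_j
  exact hj hzero_j
end

section
/- Let q be a prime power, let F be the finite field with q elements, let n be a positive integer with gcd(n, q) = 1, let μ be the multiplicative order of q modulo n, and suppose q^{⌊μ/2⌋} < n ≤ q^μ − 1. Let α be a primitive n-th root of unity in the finite field with q^μ elements, and let d satisfy 2 ≤ d ≤ min{ ⌊ n q^{⌈μ/2⌉} / (q^μ − 1) ⌋, n }. Then the narrow-sense BCH code C = { c ∈ F^n : Σ_{j=0}^{n−1} c_j α^{ij} = 0 for all i = 1, …, d − 1 }, regarded as an F-linear subspace of F^n, has dimension exactly k = n − μ ⌈ (d − 1)(1 − 1/q) ⌉. -/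
open Finset in
/-- The number of integers in `[1, N]` not divisible by `q`. -/
theorem card_filter_not_dvd_eq_ceil (N q : ℕ) :
    #{x ∈ Ioc 0 N | ¬ q ∣ x} = (⌈(N : ℚ) * (1 - 1 / (q : ℚ))⌉).toNat := by
  have h := card_filter_add_card_filter_not (s := Ioc 0 N) (fun x => q ∣ x)
  rw [Nat.Ioc_filter_dvd_card_eq_div, Nat.card_Ioc] at h
  have hceil : ⌈(N : ℚ) * (1 - 1 / (q : ℚ))⌉ = (N : ℤ) - ((N / q : ℕ) : ℤ) := by
    have e : (N : ℚ) * (1 - 1 / (q : ℚ)) = -((N : ℚ) / q) + ((N : ℤ) : ℚ) := by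
      push_cast; ring
    rw [e, Int.ceil_add_intCast, Int.ceil_neg, Rat.floor_natCast_div_natCast]
    push_cast; ring
  rw [hceil]
  omega

theorem eq_of_mul_pow_modEq_of_le_half {q n μ d x y l : ℕ} (hq : 2 ≤ q)
    (hμ : 0 < μ) (hn : n ≤ q ^ μ - 1) (hdn : d ≤ n)
    (hd : d ≤ n * q ^ ((μ + 1) / 2) / (q ^ μ - 1)) (hxd : x < d)
    (hy : 0 < y) (hyd : y < d) (hqy : ¬ q ∣ y) (hl : l ≤ μ / 2)
    (h : x * q ^ l ≡ y [MOD n]) : l = 0 ∧ x = y := by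
  have hQ : 2 ≤ q ^ μ := hq.trans (Nat.le_self_pow hμ.ne' q)
  have hA : 1 ≤ q ^ (μ / 2) := Nat.one_le_pow _ _ (by omega)
  have hAB : q ^ ((μ + 1) / 2) * q ^ (μ / 2) = q ^ μ := by
    rw [← pow_add]; congr 1; omega
  obtain ⟨Q, hQ'⟩ : ∃ Q, q ^ μ = Q + 1 := ⟨q ^ μ - 1, by omega⟩
  rw [hQ'] at hn hd hAB hQ
  rw [Nat.add_sub_cancel] at hn hd
  have h1 : d * Q ≤ n * q ^ ((μ + 1) / 2) := (Nat.le_div_iff_mul_le (by omega)).1 hd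
  have h2 : d * q ^ (μ / 2) ≤ n + 1 := by
    refine Nat.le_of_mul_le_mul_right (c := Q) ?_ (by omega)
    calc d * q ^ (μ / 2) * Q = d * Q * q ^ (μ / 2) := by ring
      _ ≤ n * q ^ ((μ + 1) / 2) * q ^ (μ / 2) := Nat.mul_le_mul_right _ h1
      _ = n * Q + n := by rw [mul_assoc, hAB]; ring
      _ ≤ (n + 1) * Q := by rw [add_mul]; omega
  have h3 : x * q ^ l ≤ n := by
    have : (x + 1) * q ^ (μ / 2) ≤ n + 1 := (Nat.mul_le_mul_right _ hxd).trans h2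
    have : x * q ^ l ≤ x * q ^ (μ / 2) :=
      Nat.mul_le_mul_left _ (Nat.pow_le_pow_right (by omega) hl)
    lia
  have h4 : x * q ^ l = y := by
    rcases h3.lt_or_eq with h3 | h3
    · exact h.eq_of_lt_of_lt h3 (by omega)
    · rw [h3] at h
      have : n ∣ y := (Nat.modEq_zero_iff_dvd).1 (h.symm.trans (by simp [Nat.ModEq]))
      have := Nat.le_of_dvd hy this
      omega
  have hl0 : l = 0 := by
    by_contra hl0
    exact hqy (h4 ▸ (dvd_pow_self q hl0).mul_left x)
  subst hl0
  exact ⟨rfl, by simpa using h4⟩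

theorem eq_of_mul_pow_modEq {q n μ d : ℕ} (hq : 2 ≤ q) (hgcd : n.Coprime q)
    (hμ : 0 < μ) (hqμ : q ^ μ ≡ 1 [MOD n]) (hn : n ≤ q ^ μ - 1) (hdn : d ≤ n)
    (hd : d ≤ n * q ^ ((μ + 1) / 2) / (q ^ μ - 1)) {x y a b : ℕ}
    (hx : 0 < x) (hxd : x < d) (hqx : ¬ q ∣ x) (hy : 0 < y) (hyd : y < d) (hqy : ¬ q ∣ y)
    (ha : a < μ) (hb : b < μ) (h : x * q ^ a ≡ y * q ^ b [MOD n]) : x = y ∧ a = b := by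
  wlog hba : b ≤ a generalizing x y a b
  · have := this hy hyd hqy hx hxd hqx hb ha h.symm (by omega)
    exact ⟨this.1.symm, this.2.symm⟩
  obtain ⟨l, rfl⟩ := Nat.exists_eq_add_of_le hba
  have h1 : x * q ^ l ≡ y [MOD n] := by
    refine Nat.ModEq.cancel_right_of_coprime (c := q ^ b) (hgcd.pow_right b) ?_
    rwa [mul_assoc, ← pow_add, add_comm l b]
  rcases le_or_gt l (μ / 2) with hl | hl
  · have := eq_of_mul_pow_modEq_of_le_half hq hμ hn hdn hd hxd hy hyd hqy hl h1
    exact ⟨this.2, by omega⟩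
  · have h2 : y * q ^ (μ - l) ≡ x [MOD n] := by
      calc y * q ^ (μ - l) ≡ x * q ^ l * q ^ (μ - l) [MOD n] := h1.symm.mul_right _
        _ = x * q ^ μ := by rw [mul_assoc, ← pow_add]; congr 2; omega
        _ ≡ x * 1 [MOD n] := hqμ.mul_left x
        _ = x := mul_one x
    have := eq_of_mul_pow_modEq_of_le_half hq hμ hn hdn hd hyd hx hxd hqx (by omega) h2
    omega

/-- Distinct `n`-torsion elements of a field have linearly independent sequences of
powers, already on the exponents below `n`. -/
theorem eq_zero_of_sum_mul_pow_eq_zero {E ι : Type*} [Field E] [Fintype ι] {n : ℕ} (hn : 0 < n)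
    (β : ι → E) (hβ : Function.Injective β) (hβn : ∀ i, β i ^ n = 1) (b : ι → E)
    (h : ∀ j < n, ∑ i, b i * β i ^ j = 0) : b = 0 := by
  have hinj : Function.Injective (fun i => powersHom E (β i)) :=
    (powersHom E).injective.comp hβ
  have hli := (linearIndependent_monoidHom (Multiplicative ℕ) E).comp _ hinj
  rw [Fintype.linearIndependent_iff] at hli
  funext i
  refine hli b ?_ i
  funext j
  have hj := h (j.toAdd % n) (Nat.mod_lt _ hn)
  simp only [Finset.sum_apply, Pi.smul_apply, Function.comp_apply, powersHom_apply, smul_eq_mul,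
    Pi.zero_apply]
  rw [← hj]
  exact Finset.sum_congr rfl fun i _ => by rw [← pow_eq_pow_mod _ (hβn i)]

/-- Evaluation of the polynomial `∑ c_j X^j` at the points `β_x`, as a linear map over the
base field. -/
noncomputable def evalPoints (F : Type*) {E ι : Type*} [Field F] [Field E] [Algebra F E] (n : ℕ)
    (β : ι → E) : (Fin n → F) →ₗ[F] (ι → E) :=
  LinearMap.pi fun x => Fintype.linearCombination F fun j : Fin n => β x ^ (j : ℕ)

theorem evalPoints_apply {F E ι : Type*} [Field F] [Field E] [Algebra F E] {n : ℕ}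
    (β : ι → E) (c : Fin n → F) (x : ι) :
    evalPoints F n β c x = ∑ j, algebraMap F E (c j) * β x ^ (j : ℕ) := by
  simp [evalPoints, Fintype.linearCombination_apply, Algebra.smul_def]

/-- Evaluation is onto when the Frobenius conjugates of the evaluation points are pairwise
distinct. -/
theorem evalPoints_surjective {F E ι : Type*} [Field F] [Finite F] [Field E] [Finite E]
    [Algebra F E] [Fintype ι] {n : ℕ} (hn : 0 < n) (β : ι → E) (hβn : ∀ i, β i ^ n = 1)
    (hβ : Function.Injective
      fun s : ι × Fin (Module.finrank F E) => β s.1 ^ Nat.card F ^ (s.2 : ℕ)) :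
    Function.Surjective (evalPoints F n β) := by
  classical
  rw [← LinearMap.dualMap_injective_iff, injective_iff_map_eq_zero]
  intro f hf
  have hnd := traceForm_nondegenerate F E
  let a : ι → E := fun x => ((Algebra.traceForm F E).toDual hnd).symm
    (f ∘ₗ LinearMap.single F (fun _ => E) x)
  have ha : ∀ x v, Algebra.trace F E (a x * v) = f (Pi.single x v) := fun x v =>
    LinearMap.BilinForm.apply_toDual_symm_apply (hB := hnd)
      (f ∘ₗ LinearMap.single F (fun _ => E) x) v
  have hfa : ∀ v, f v = ∑ x, Algebra.trace F E (a x * v x) := fun v => by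
    simp_rw [ha, ← map_sum, Finset.univ_sum_single]
  have hb := eq_zero_of_sum_mul_pow_eq_zero hn _ hβ
    (fun s => by rw [pow_right_comm, hβn, one_pow])
    (fun s => a s.1 ^ Nat.card F ^ (s.2 : ℕ)) fun j hj => by
      have h0 := LinearMap.congr_fun hf (Pi.single (⟨j, hj⟩ : Fin n) 1)
      have hev : evalPoints F n β (Pi.single (⟨j, hj⟩ : Fin n) 1) = fun x => β x ^ j := by
        funext x
        simp [evalPoints_apply, Pi.single_apply]
      rw [LinearMap.dualMap_apply, hev, hfa, LinearMap.zero_apply] at h0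
      have h1 := congrArg (algebraMap F E) h0
      simp_rw [map_sum, FiniteField.algebraMap_trace_eq_sum_pow, Finset.sum_range, mul_pow] at h1
      rw [map_zero] at h1
      rw [Fintype.sum_prod_type, ← h1]
      refine Finset.sum_congr rfl fun x _ => Finset.sum_congr rfl fun k _ => ?_
      rw [pow_right_comm]
  have ha0 : a = 0 := by
    funext x
    have := congrFun hb (x, ⟨0, Module.finrank_pos⟩)
    simpa using this
  ext1 x
  ext v
  simp [← ha, ha0]

theorem sum_algebraMap_mul_pow_card {F E : Type*} [Field F] [Fintype F] [Field E] [Algebra F E]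
    {n : ℕ} (c : Fin n → F) (β : E) :
    ∑ j, algebraMap F E (c j) * (β ^ Fintype.card F) ^ (j : ℕ) =
      (∑ j, algebraMap F E (c j) * β ^ (j : ℕ)) ^ Fintype.card F := by
  have h := map_sum (FiniteField.frobeniusAlgHom F E)
    (fun j => algebraMap F E (c j) * β ^ (j : ℕ)) Finset.univ
  simp only [map_mul, AlgHom.commutes, map_pow, FiniteField.frobeniusAlgHom_apply] at h
  exact h.symm

theorem eval_pow_eq_zero_of_forall_not_dvd {F E : Type*} [Field F] [Fintype F] [Field E]
    [Algebra F E] {n d : ℕ} (c : Fin n → F) (α : E)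
    (h : ∀ i, 0 < i → i < d → ¬ Fintype.card F ∣ i →
      ∑ j, algebraMap F E (c j) * (α ^ i) ^ (j : ℕ) = 0) (i : ℕ) (hi : 0 < i) (hid : i < d) :
    ∑ j, algebraMap F E (c j) * (α ^ i) ^ (j : ℕ) = 0 := by
  induction i using Nat.strong_induction_on with
  | _ i ih =>
    by_cases hdvd : Fintype.card F ∣ i
    · obtain ⟨k, rfl⟩ := hdvd
      have hk : 0 < k := Nat.pos_of_mul_pos_left hi
      have hlt : k < Fintype.card F * k := lt_mul_of_one_lt_left hk Fintype.one_lt_card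
      rw [mul_comm, pow_mul, sum_algebraMap_mul_pow_card, ih k hlt hk (hlt.trans hid),
        zero_pow Fintype.card_ne_zero]
    · exact h i hi hid hdvd


/-- Dimension of narrow-sense BCH codes with small designed distance
(Theorem of the paper / [Aly-Klappenecker-Sarvepalli, Theorem 10]):
for `q` a prime power, `gcd(n, q) = 1`, `μ` the multiplicative order of `q` mod `n`,
`q^{⌊μ/2⌋} < n ≤ q^μ - 1`, and designed distance
`2 ≤ d ≤ min{⌊n·q^{⌈μ/2⌉}/(q^μ - 1)⌋, n}`, the narrow-sense BCH code
`C = {c ∈ F_q^n : ∑_j c_j α^{ij} = 0 for i = 1, …, d-1}` has dimension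
`k = n - μ·⌈(d-1)(1 - 1/q)⌉`. -/
theorem bch_dimension (p r q : ℕ) (hp : p.Prime) (hr : 1 ≤ r) (hq : q = p ^ r)
    (F : Type*) [Field F] [Fintype F] [DecidableEq F] (hF : Fintype.card F = q)
    (n : ℕ) (hn : 0 < n) (hgcd : Nat.gcd n q = 1)
    (μ : ℕ) (hμpos : 0 < μ) (hμ : q ^ μ ≡ 1 [MOD n])
    (hμmin : ∀ m : ℕ, 0 < m → q ^ m ≡ 1 [MOD n] → μ ≤ m)
    (hnlow : q ^ (μ / 2) < n) (hnhigh : n ≤ q ^ μ - 1)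
    (E : Type*) [Field E] [Fintype E] [Algebra F E] (hE : Fintype.card E = q ^ μ)
    (α : E) (hα : orderOf α = n)
    (d : ℕ) (hd2 : 2 ≤ d) (hdmax : d ≤ min (n * q ^ ((μ + 1) / 2) / (q ^ μ - 1)) n)
    (C : Submodule F (Fin n → F))
    (hC : ∀ c : Fin n → F, c ∈ C ↔ ∀ i : ℕ, 1 ≤ i → i ≤ d - 1 →
      ∑ j : Fin n, algebraMap F E (c j) * α ^ (i * (j : ℕ)) = 0) :
    Module.finrank F C = n - μ * (⌈((d : ℚ) - 1) * (1 - 1 / (q : ℚ))⌉).toNat := by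
  classical
  have hq2 : 2 ≤ q := hF ▸ Fintype.one_lt_card
  obtain ⟨hd, hdn⟩ := le_min_iff.1 hdmax
  have hrank : Module.finrank F E = μ := by
    have h := Module.card_eq_pow_finrank (K := F) (V := E)
    rw [hE, hF] at h
    exact (Nat.pow_right_injective hq2 h).symm
  let S : Finset ℕ := {x ∈ Finset.Ioc 0 (d - 1) | ¬ q ∣ x}
  have hS : ∀ x ∈ S, 0 < x ∧ x < d ∧ ¬ q ∣ x := fun x hx => by
    simp only [S, Finset.mem_filter, Finset.mem_Ioc] at hx
    exact ⟨hx.1.1, by omega, hx.2⟩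
  let β : S → E := fun x => α ^ (x : ℕ)
  have hβn : ∀ x, β x ^ n = 1 := fun x => by
    rw [pow_right_comm, ← hα, pow_orderOf_eq_one, one_pow]
  have hα0 : α ≠ 0 := by
    rintro rfl
    have := pow_orderOf_eq_one (0 : E)
    rw [hα, zero_pow hn.ne'] at this
    exact zero_ne_one this
  have hβ : Function.Injective
      fun s : S × Fin (Module.finrank F E) => β s.1 ^ Nat.card F ^ (s.2 : ℕ) := by
    rintro ⟨⟨x, hx⟩, a⟩ ⟨⟨y, hy⟩, b⟩ h
    simp only [β, Nat.card_eq_fintype_card, hF, ← pow_mul] at h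
    obtain ⟨hx0, hxd, hqx⟩ := hS x hx
    obtain ⟨hy0, hyd, hqy⟩ := hS y hy
    have hmod : x * q ^ (a : ℕ) ≡ y * q ^ (b : ℕ) [MOD n] := by
      have hu : Units.mk0 α hα0 ^ (x * q ^ (a : ℕ)) = Units.mk0 α hα0 ^ (y * q ^ (b : ℕ)) :=
        Units.ext (by simpa using h)
      rw [pow_eq_pow_iff_modEq, ← orderOf_units, Units.val_mk0, hα] at hu
      exact hu
    obtain ⟨hxy, hab⟩ := eq_of_mul_pow_modEq hq2 hgcd hμpos hμ hnhigh hdn hd hx0 hxd hqx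
      hy0 hyd hqy (a.2.trans_eq hrank) (b.2.trans_eq hrank) hmod
    simp only [Prod.mk.injEq, Subtype.mk.injEq]
    exact ⟨hxy, Fin.ext hab⟩
  have hsurj := evalPoints_surjective hn β hβn hβ
  have hker : C = LinearMap.ker (evalPoints F n β) := by
    ext c
    simp only [hC, LinearMap.mem_ker, funext_iff, evalPoints_apply, pow_mul, Pi.zero_apply]
    constructor
    · rintro h ⟨x, hx⟩
      obtain ⟨hx0, hxd, -⟩ := hS x hx
      exact h x hx0 (by omega)
    · intro h i hi hid
      refine eval_pow_eq_zero_of_forall_not_dvd (d := d) c α (fun x hx0 hxd hqx => ?_) i hi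
        (by omega)
      exact h ⟨x, by
        simp only [S, Finset.mem_filter, Finset.mem_Ioc]
        exact ⟨⟨hx0, by omega⟩, hF ▸ hqx⟩⟩
  have hdim := LinearMap.finrank_range_add_finrank_ker (evalPoints F n β)
  rw [LinearMap.range_eq_top.2 hsurj, finrank_top, Module.finrank_pi_fintype, ← hker,
    Module.finrank_fin_fun] at hdim
  simp only [hrank, Finset.sum_const, Finset.card_univ, Fintype.card_coe, smul_eq_mul] at hdim
  have hcard := card_filter_not_dvd_eq_ceil (d - 1) q
  rw [Nat.cast_sub (by omega), Nat.cast_one] at hcard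
  rw [← hcard, mul_comm μ]
  exact Nat.eq_sub_of_add_eq' hdim
end
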